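/- arXiv:1502.01543 — 7 statements merged into one kernel-verified Lean document; each statement's English description precedes it below -/
import Mathlib

section
/- For all integers n and k with n ≥ k+1 ≥ 2, the average k-alternating length of permutations in S_n equals (4(n-k)+5)/6; equivalently, 6 · Σ_{w ∈ S_n} as_k(w) = (4(n-k)+5) · n!. -/
open Nat

/-- `ι` enumerates (the positions of) an alternating subsequence of `w`:
positions are strictly increasing and the values satisfy `w_{i₁} > w_{i₂} < w_{i₃} > ⋯`. -/
def IsAltSeq {n : ℕ} (w : Equiv.Perm (Fin n)) {s : ℕ} (ι : Fin s → Fin n) : Prop :=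
  StrictMono ι ∧
    ∀ (j : ℕ) (hj : j + 1 < s),
      if j % 2 = 0 then
        (w (ι ⟨j + 1, hj⟩) : ℕ) < (w (ι ⟨j, Nat.lt_of_succ_lt hj⟩) : ℕ)
      else
        (w (ι ⟨j, Nat.lt_of_succ_lt hj⟩) : ℕ) < (w (ι ⟨j + 1, hj⟩) : ℕ)

/-- `ι` enumerates a reverse alternating subsequence of `w`:
`w_{i₁} < w_{i₂} > w_{i₃} < ⋯`. -/
def IsRevAltSeq {n : ℕ} (w : Equiv.Perm (Fin n)) {s : ℕ} (ι : Fin s → Fin n) : Prop :=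
  StrictMono ι ∧
    ∀ (j : ℕ) (hj : j + 1 < s),
      if j % 2 = 0 then
        (w (ι ⟨j, Nat.lt_of_succ_lt hj⟩) : ℕ) < (w (ι ⟨j + 1, hj⟩) : ℕ)
      else
        (w (ι ⟨j + 1, hj⟩) : ℕ) < (w (ι ⟨j, Nat.lt_of_succ_lt hj⟩) : ℕ)

/-- Each pair of neighbouring entries of the subsequence differs by at least `k`
in absolute value. -/
def HasGaps (k : ℕ) {n : ℕ} (w : Equiv.Perm (Fin n)) {s : ℕ} (ι : Fin s → Fin n) : Prop :=
  ∀ (j : ℕ) (hj : j + 1 < s),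
    (k : ℤ) ≤ |((w (ι ⟨j, Nat.lt_of_succ_lt hj⟩) : ℕ) : ℤ) -
               ((w (ι ⟨j + 1, hj⟩) : ℕ) : ℤ)|

/-- `as_k(w)`: the maximal length of a `k`-alternating subsequence of `w`. -/
noncomputable def kAltLen (n k : ℕ) (w : Equiv.Perm (Fin n)) : ℕ :=
  sSup {s : ℕ | ∃ ι : Fin s → Fin n, IsAltSeq w ι ∧ HasGaps k w ι}

/-- The maximal length of a `k`-reverse-alternating subsequence of `w`. -/
noncomputable def kRevAltLen (n k : ℕ) (w : Equiv.Perm (Fin n)) : ℕ :=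
  sSup {s : ℕ | ∃ ι : Fin s → Fin n, IsRevAltSeq w ι ∧ HasGaps k w ι}

/-- `zs_k(w)`: the maximal length of a `k`-zigzagging subsequence of `w`. -/
noncomputable def kZigLen (n k : ℕ) (w : Equiv.Perm (Fin n)) : ℕ :=
  sSup {s : ℕ | ∃ ι : Fin s → Fin n, (IsAltSeq w ι ∨ IsRevAltSeq w ι) ∧ HasGaps k w ι}

/-- The section `w_s ⋯ w_t` is a `k`-up: `s < t` and `w_t - w_s ≥ k`. -/
def IsKUp (k : ℕ) {n : ℕ} (w : Equiv.Perm (Fin n)) (s t : Fin n) : Prop :=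
  s < t ∧ (w s : ℕ) + k ≤ (w t : ℕ)

/-- The section `w_s ⋯ w_t` is a `k`-down: `s < t` and `w_s - w_t ≥ k`. -/
def IsKDown (k : ℕ) {n : ℕ} (w : Equiv.Perm (Fin n)) (s t : Fin n) : Prop :=
  s < t ∧ (w t : ℕ) + k ≤ (w s : ℕ)

/-- The section `w_i ⋯ w_j` is `k`-ascending: `w_i` is its minimum, `w_j` its maximum,
`w_j - w_i ≥ k`, and there is no `k`-down inside it. -/
def IsKAsc (k : ℕ) {n : ℕ} (w : Equiv.Perm (Fin n)) (i j : Fin n) : Prop :=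
  i < j ∧
  (∀ t : Fin n, i ≤ t → t ≤ j → (w i : ℕ) ≤ (w t : ℕ) ∧ (w t : ℕ) ≤ (w j : ℕ)) ∧
  (w i : ℕ) + k ≤ (w j : ℕ) ∧
  ∀ s t : Fin n, i ≤ s → t ≤ j → ¬ IsKDown k w s t

/-- The section `w_i ⋯ w_j` is `k`-descending: `w_i` is its maximum, `w_j` its minimum,
`w_i - w_j ≥ k`, and there is no `k`-up inside it. -/
def IsKDesc (k : ℕ) {n : ℕ} (w : Equiv.Perm (Fin n)) (i j : Fin n) : Prop :=
  i < j ∧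
  (∀ t : Fin n, i ≤ t → t ≤ j → (w t : ℕ) ≤ (w i : ℕ) ∧ (w j : ℕ) ≤ (w t : ℕ)) ∧
  (w j : ℕ) + k ≤ (w i : ℕ) ∧
  ∀ s t : Fin n, i ≤ s → t ≤ j → ¬ IsKUp k w s t

/-- `w_i ⋯ w_j` is a maximal `k`-ascending section: it is `k`-ascending and it is not
contained in any other `k`-ascending section. -/
def IsMaxKAsc (k : ℕ) {n : ℕ} (w : Equiv.Perm (Fin n)) (i j : Fin n) : Prop :=
  IsKAsc k w i j ∧ ∀ i' j' : Fin n, IsKAsc k w i' j' → i' ≤ i → j ≤ j' → i' = i ∧ j' = j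

/-- `w_i ⋯ w_j` is a maximal `k`-descending section. -/
def IsMaxKDesc (k : ℕ) {n : ℕ} (w : Equiv.Perm (Fin n)) (i j : Fin n) : Prop :=
  IsKDesc k w i j ∧ ∀ i' j' : Fin n, IsKDesc k w i' j' → i' ≤ i → j ≤ j' → i' = i ∧ j' = j

/-- `w_p` is a `k`-peak of `w`: `p` is the right end of a maximal `k`-ascending section
or the left end of a maximal `k`-descending section. -/
def IsKPeakPos (k : ℕ) {n : ℕ} (w : Equiv.Perm (Fin n)) (p : Fin n) : Prop :=
  (∃ i, IsMaxKAsc k w i p) ∨ (∃ j, IsMaxKDesc k w p j)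

/-- `w_p` is a `k`-valley of `w`: `p` is the left end of a maximal `k`-ascending section
or the right end of a maximal `k`-descending section. -/
def IsKValleyPos (k : ℕ) {n : ℕ} (w : Equiv.Perm (Fin n)) (p : Fin n) : Prop :=
  (∃ j, IsMaxKAsc k w p j) ∨ (∃ i, IsMaxKDesc k w i p)

/-- The entry `f p` is a peak of prominence at least `k`: on either side, the entries met before
the first one exceeding `f p` include one that is at most `f p - k`, unless no entry on that side
exceeds `f p`. -/
def IsProminent {α : Type*} [LinearOrder α] (k : ℤ) (f : α → ℤ) (p : α) : Prop :=
  (∀ x, x < p → f p < f x → ∃ y, x < y ∧ y < p ∧ f y + k ≤ f p) ∧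
    ∀ x, p < x → f p < f x → ∃ y, p < y ∧ y < x ∧ f y + k ≤ f p

/-- A valley of depth at least `k` that is preceded by an entry exceeding it by at least `k`. -/
def IsDeepValley {α : Type*} [LinearOrder α] (k : ℤ) (f : α → ℤ) (p : α) : Prop :=
  IsProminent k (-f) p ∧ ∃ x, x < p ∧ f p + k ≤ f x

section Prominence

variable {α : Type*} [LinearOrder α] [Fintype α] {k : ℤ} {f : α → ℤ} {p q : α}

theorem IsProminent.exists_prominent_neg_between (hk : 0 < k) (hp : IsProminent k f p)
    (hq : IsProminent k f q) (hf : Function.Injective f) (hpq : p < q) :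
    ∃ r, p < r ∧ r < q ∧ IsProminent k (-f) r ∧ f r + k ≤ f p ∧ f r + k ≤ f q := by
  obtain ⟨y, hy⟩ : ∃ y, p < y ∧ y < q ∧ f y + k ≤ f p ∧ f y + k ≤ f q := by
    rcases lt_trichotomy (f p) (f q) with h | h | h
    · obtain ⟨y, h1, h2, h3⟩ := hp.2 q hpq h
      exact ⟨y, h1, h2, h3, by omega⟩
    · exact absurd (hf h) hpq.ne
    · obtain ⟨y, h1, h2, h3⟩ := hq.1 p hpq h
      exact ⟨y, h1, h2, by omega, h3⟩
  obtain ⟨r, hr, hmin⟩ := Finset.exists_min_image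
    (Finset.univ.filter fun x => p < x ∧ x < q) f ⟨y, by simp [hy.1, hy.2.1]⟩
  simp only [Finset.mem_filter, Finset.mem_univ, true_and] at hr hmin
  have hry := hmin y ⟨hy.1, hy.2.1⟩
  refine ⟨r, hr.1, hr.2, ⟨fun x hx hlt => ?_, fun x hx hlt => ?_⟩, by omega, by omega⟩ <;>
    simp only [Pi.neg_apply] at hlt ⊢
  · have hxp : ¬ p < x := fun h => by have := hmin x ⟨h, hx.trans hr.2⟩; omega
    have hne : x ≠ p := by rintro rfl; omega
    exact ⟨p, lt_of_le_of_ne (not_lt.1 hxp) hne, hr.1, by omega⟩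
  · have hxq : ¬ x < q := fun h => by have := hmin x ⟨hr.1.trans hx, h⟩; omega
    have hne : q ≠ x := by rintro rfl; omega
    exact ⟨q, hr.2, lt_of_le_of_ne (not_lt.1 hxq) hne, by omega⟩

theorem IsDeepValley.exists_prominent_lt (hk : 0 < k) (hq : IsDeepValley k f q) :
    ∃ r, r < q ∧ IsProminent k f r := by
  obtain ⟨x, hx, hxq⟩ := hq.2
  obtain ⟨r, hr, hmax⟩ := Finset.exists_max_image
    (Finset.univ.filter fun x => x < q) f ⟨x, by simp [hx]⟩
  simp only [Finset.mem_filter, Finset.mem_univ, true_and] at hr hmax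
  have hrx := hmax x hx
  refine ⟨r, hr, fun y hy hlt => ?_, fun y hy hlt => ?_⟩
  · have := hmax y (hy.trans hr); omega
  · have hyq : ¬ y < q := fun h => by have := hmax y h; omega
    have hne : q ≠ y := by rintro rfl; omega
    exact ⟨q, hr, lt_of_le_of_ne (not_lt.1 hyq) hne, by omega⟩

/-- Two opposite extrema with no entry of height at least `f q + k` between them cannot be close in
value, once such an entry occurs earlier. -/
theorem IsProminent.not_exists_high (hp : IsProminent k f p)
    (hq : IsProminent k (-f) q) (hpq : p ≤ q) (hgap : f p < f q + k)
    (hlow : ∀ z, p ≤ z → z ≤ q → f z < f q + k) :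
    ¬ ∃ x, x < p ∧ f q + k ≤ f x := by
  rintro ⟨x, hx⟩
  obtain ⟨r, hr, hmax⟩ := Finset.exists_max_image
    (Finset.univ.filter fun x => x < p ∧ f q + k ≤ f x) id ⟨x, by simp [hx]⟩
  simp only [Finset.mem_filter, Finset.mem_univ, true_and, id] at hr hmax
  obtain ⟨y, hry, hyp, hy⟩ := hp.1 r hr.1 (by omega)
  obtain ⟨z, hyz, hzq, hz⟩ := hq.1 y (hyp.trans_le hpq) (by simp only [Pi.neg_apply]; omega)
  simp only [Pi.neg_apply] at hz
  have hzp : z < p := by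
    by_contra h
    have := hlow z (not_lt.1 h) hzq.le
    omega
  exact absurd (hmax z ⟨hzp, by omega⟩) (not_le.2 (hry.trans hyz))

theorem IsProminent.not_isDeepValley (hk : 0 < k) (hp : IsProminent k f p) :
    ¬ IsDeepValley k f p := fun hv =>
  hp.not_exists_high hv.1 le_rfl (by omega)
    (fun z h1 h2 => by rw [le_antisymm h2 h1]; omega) hv.2

/-- Consecutive extrema of opposite type differ by at least `k`. -/
theorem IsProminent.add_le_of_consecutive (hk : 0 < k) (hp : IsProminent k f p)
    (hq : IsProminent k (-f) q) (hpq : p < q)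
    (hpeak : ∀ r, p < r → r < q → IsProminent k f r → ∀ y, y < r → f r < f y + k)
    (hentry : (∃ x, x < q ∧ f q + k ≤ f x) ∨ ∃ x, x < p ∧ f x + k ≤ f p) :
    f q + k ≤ f p := by
  by_contra! hlt
  obtain ⟨r, hr, hmax⟩ := Finset.exists_max_image
    (Finset.univ.filter fun x => p ≤ x ∧ x ≤ q) f ⟨p, by simp [hpq.le]⟩
  simp only [Finset.mem_filter, Finset.mem_univ, true_and] at hr hmax
  have hpr := hmax p ⟨le_rfl, hpq.le⟩
  have no_high : ∀ z, p ≤ z → z ≤ q → f z < f q + k := by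
    by_contra! hz
    obtain ⟨z, hpz, hzq, hz⟩ := hz
    have hrz := hmax z ⟨hpz, hzq⟩
    have hrp : p < r := lt_of_le_of_ne hr.1 (by rintro rfl; omega)
    have hrq : r < q := lt_of_le_of_ne hr.2 (by rintro rfl; omega)
    obtain ⟨y, hy1, hy2, hy3⟩ := hp.2 r hrp (by omega)
    refine absurd (hpeak r hrp hrq ⟨fun x hx hlt' => ?_, fun x hx hlt' => ?_⟩ y hy2)
      (not_lt.2 (by omega))
    · have hxp : x < p := by
        by_contra h
        have := hmax x ⟨not_lt.1 h, (hx.trans hrq).le⟩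
        omega
      exact ⟨y, hxp.trans hy1, hy2, by omega⟩
    · have hxq : q < x := by
        by_contra h
        have := hmax x ⟨(hrp.trans hx).le, not_lt.1 h⟩
        omega
      exact ⟨q, hrq, hxq, by omega⟩
  refine hp.not_exists_high hq hpq.le hlt no_high ?_
  rcases hentry with ⟨x, hxq, hx⟩ | ⟨x, hxp, hx⟩
  · refine ⟨x, ?_, hx⟩
    by_contra h
    have := no_high x (not_lt.1 h) hxq.le
    omega
  · obtain ⟨y, -, hyq, hy⟩ := hq.1 x (hxp.trans hpq) (by simp only [Pi.neg_apply]; omega)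
    simp only [Pi.neg_apply] at hy
    refine ⟨y, ?_, by omega⟩
    by_contra h
    have := no_high y (not_lt.1 h) hyq.le
    omega

end Prominence
section AltLen

/-- The word `w_1 ⋯ w_n` as an integer-valued function of the position. -/
def entry {n : ℕ} (w : Equiv.Perm (Fin n)) (p : Fin n) : ℤ := ((w p : ℕ) : ℤ)

theorem entry_injective {n : ℕ} (w : Equiv.Perm (Fin n)) : Function.Injective (entry w) :=
  fun a b h => w.injective (Fin.ext (by simpa [entry] using h))

theorem isAltSeq_and_hasGaps_iff {n k s : ℕ} (hk : 0 < k) (w : Equiv.Perm (Fin n))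
    (ι : Fin s → Fin n) :
    IsAltSeq w ι ∧ HasGaps k w ι ↔ StrictMono ι ∧ ∀ (j : ℕ) (hj : j + 1 < s),
      if j % 2 = 0 then
        entry w (ι ⟨j + 1, hj⟩) + k ≤ entry w (ι ⟨j, Nat.lt_of_succ_lt hj⟩)
      else
        entry w (ι ⟨j, Nat.lt_of_succ_lt hj⟩) + k ≤ entry w (ι ⟨j + 1, hj⟩) := by
  unfold IsAltSeq HasGaps entry
  rw [and_assoc]
  refine and_congr_right fun _ => ?_
  rw [← forall_and]
  refine forall_congr' fun j => ?_
  rw [← forall_and]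
  refine forall_congr' fun hj => ?_
  split_ifs <;> rw [le_abs] <;> omega

theorem exists_prominent_in_window {n s : ℕ} {k : ℤ} (hk : 0 < k) {f : Fin n → ℤ}
    {ι : Fin s → Fin n} (hι : StrictMono ι) (j : Fin s)
    (h : ∀ i : Fin s, (i : ℕ) + 1 = j ∨ (j : ℕ) + 1 = i → f (ι i) + k ≤ f (ι j)) :
    ∃ p, IsProminent k f p ∧ f (ι j) ≤ f p ∧
      ∀ i : Fin s, ((i : ℕ) + 1 = j → ι i < p) ∧ ((j : ℕ) + 1 = i → p < ι i) := by
  obtain ⟨p, hp, hmax⟩ := Finset.exists_max_image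
    (Finset.univ.filter fun x =>
      ∀ i : Fin s, ((i : ℕ) + 1 = j → ι i < x) ∧ ((j : ℕ) + 1 = i → x < ι i)) f
    ⟨ι j, by
      simp only [Finset.mem_filter, Finset.mem_univ, true_and]
      exact fun i => ⟨fun h => hι (Fin.lt_def.2 (by omega)), fun h => hι (Fin.lt_def.2 (by omega))⟩⟩
  simp only [Finset.mem_filter, Finset.mem_univ, true_and] at hp hmax
  have hj := hmax (ι j)
    fun i => ⟨fun h => hι (Fin.lt_def.2 (by omega)), fun h => hι (Fin.lt_def.2 (by omega))⟩
  refine ⟨p, ⟨fun x hx hlt => ?_, fun x hx hlt => ?_⟩, hj, hp⟩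
  all_goals
    have hout : ¬ ∀ i : Fin s, ((i : ℕ) + 1 = j → ι i < x) ∧ ((j : ℕ) + 1 = i → x < ι i) :=
      fun hin => absurd (hmax x hin) (not_le.2 hlt)
    push Not at hout
    obtain ⟨i, hi⟩ := hout
  · have hij : (i : ℕ) + 1 = j ∧ x ≤ ι i := by
      by_contra hcon
      obtain ⟨h1, h2⟩ := hi fun h1 => not_le.1 fun h2 => hcon ⟨h1, h2⟩
      exact absurd (h2.trans_lt hx) ((hp i).2 h1).not_gt
    have hik := h i (Or.inl hij.1)
    refine ⟨ι i, lt_of_le_of_ne hij.2 ?_, (hp i).1 hij.1, by omega⟩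
    rintro rfl
    omega
  · have hij : (j : ℕ) + 1 = i ∧ ι i ≤ x := by
      by_cases h1 : (i : ℕ) + 1 = j ∧ x ≤ ι i
      · exact absurd (hx.trans_le h1.2) ((hp i).1 h1.1).not_gt
      · exact hi fun h2 => not_le.1 fun h3 => h1 ⟨h2, h3⟩
    have hik := h i (Or.inr hij.1)
    refine ⟨ι i, (hp i).2 hij.1, lt_of_le_of_ne hij.2 ?_, by omega⟩
    rintro rfl
    omega

open Classical in
theorem card_le_of_alternating {n s : ℕ} {k : ℤ} (hk : 0 < k) {f : Fin n → ℤ}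
    {ι : Fin s → Fin n} (hι : StrictMono ι)
    (h : ∀ (j : ℕ) (hj : j + 1 < s),
      if j % 2 = 0 then f (ι ⟨j + 1, hj⟩) + k ≤ f (ι ⟨j, Nat.lt_of_succ_lt hj⟩)
      else f (ι ⟨j, Nat.lt_of_succ_lt hj⟩) + k ≤ f (ι ⟨j + 1, hj⟩)) :
    s ≤ (Finset.univ.filter fun p => IsProminent k f p ∨ IsDeepValley k f p).card := by
  have key : ∀ j : Fin s, ∃ p,
      (if (j : ℕ) % 2 = 0 then IsProminent k f p else IsDeepValley k f p) ∧
      ∀ i : Fin s, ((i : ℕ) + 1 = j → ι i < p) ∧ ((j : ℕ) + 1 = i → p < ι i) := by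
    intro j
    split_ifs with hj
    · obtain ⟨p, hp, -, hw⟩ := exists_prominent_in_window hk (f := f) hι j (by
        rintro ⟨i, hi⟩ (hij | hij)
        · have := h i (by simp only at hij; omega)
          simp only at hij
          rw [if_neg (by omega)] at this
          simpa only [hij] using this
        · have := h j (by simp only at hij; omega)
          rw [if_pos hj] at this
          simpa only [hij] using this)
      exact ⟨p, hp, hw⟩
    · obtain ⟨p, hp, hle, hw⟩ := exists_prominent_in_window hk (f := -f) hι j (by
        simp only [Pi.neg_apply]
        rintro ⟨i, hi⟩ (hij | hij)
        · have := h i (by simp only at hij; omega)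
          simp only at hij
          rw [if_pos (by omega)] at this
          simp only [hij, Fin.eta] at this
          omega
        · have := h j (by simp only at hij; omega)
          rw [if_neg hj] at this
          simp only [hij, Fin.eta] at this
          omega)
      obtain ⟨i, hi⟩ : ∃ i, i + 1 = (j : ℕ) := ⟨j - 1, by omega⟩
      have := h i (by omega)
      rw [if_pos (by omega)] at this
      simp only [hi, Fin.eta] at this
      simp only [Pi.neg_apply] at hle
      exact ⟨p, ⟨hp, ι ⟨i, by omega⟩, (hw _).1 hi, by omega⟩, hw⟩
  choose g hg hwin using key
  have hlt : ∀ i j, i < j → g i ≠ g j := by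
    intro i j hij heq
    have hi := hg i
    have hj := hg j
    rw [← heq] at hj
    rw [Fin.lt_def] at hij
    by_cases hpar : (i : ℕ) % 2 = (j : ℕ) % 2
    · have h1 := (hwin i ⟨i + 1, by omega⟩).2 rfl
      have h2 := (hwin j ⟨j - 1, by omega⟩).1 (by simp only; omega)
      have h3 : ι ⟨i + 1, by omega⟩ ≤ ι ⟨j - 1, by omega⟩ :=
        hι.monotone (Fin.le_def.2 (by simp only; omega))
      exact absurd heq (h1.trans_le h3 |>.trans h2).ne
    · split_ifs at hi hj
      · omega
      · exact hi.not_isDeepValley hk hj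
      · exact hj.not_isDeepValley hk hi
      · omega
  have hinj : Function.Injective g := fun i j heq => by
    rcases lt_trichotomy i j with h | h | h
    · exact absurd heq (hlt i j h)
    · exact h
    · exact absurd heq.symm (hlt j i h)
  simpa using Finset.card_le_card_of_injOn (s := (Finset.univ : Finset (Fin s))) g
    (fun i _ => by
      have := hg i
      simp only [Finset.coe_filter, Finset.mem_univ, true_and, Set.mem_ofPred_eq]
      split_ifs at this
      · exact Or.inl this
      · exact Or.inr this) hinj.injOn

open Classical in
theorem alternating_orderEmbOfFin {n : ℕ} {k : ℤ} (hk : 0 < k) {f : Fin n → ℤ}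
    (hf : Function.Injective f) {s : ℕ}
    (hs : (Finset.univ.filter fun p => IsProminent k f p ∨ IsDeepValley k f p).card = s)
    (j : ℕ) (hj : j + 1 < s) :
    let ι := Finset.orderEmbOfFin _ hs
    if j % 2 = 0 then f (ι ⟨j + 1, hj⟩) + k ≤ f (ι ⟨j, Nat.lt_of_succ_lt hj⟩)
    else f (ι ⟨j, Nat.lt_of_succ_lt hj⟩) + k ≤ f (ι ⟨j + 1, hj⟩) := by
  intro ι
  have hmem : ∀ i, IsProminent k f (ι i) ∨ IsDeepValley k f (ι i) := fun i => by
    simpa only [Finset.mem_filter, Finset.mem_univ, true_and] using Finset.orderEmbOfFin_mem _ hs i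
  have hsurj : ∀ p, IsProminent k f p ∨ IsDeepValley k f p → ∃ i, ι i = p := fun p hp => by
    have : p ∈ Set.range ι := by
      rw [Finset.range_orderEmbOfFin]
      simpa using hp
    exact this
  have hnone : ∀ (i : ℕ) (hi : i + 1 < s) p, ι ⟨i, by omega⟩ < p → p < ι ⟨i + 1, hi⟩ →
      ¬ (IsProminent k f p ∨ IsDeepValley k f p) := by
    intro i hi p h1 h2 hp
    obtain ⟨l, rfl⟩ := hsurj p hp
    rw [OrderEmbedding.lt_iff_lt, Fin.lt_def] at h1 h2
    simp only at h1 h2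
    omega
  have hstep : ∀ (i : ℕ) (hi : i + 1 < s), ι ⟨i, by omega⟩ < ι ⟨i + 1, hi⟩ := fun i hi => by
    rw [OrderEmbedding.lt_iff_lt, Fin.lt_def]
    exact Nat.lt_succ_self i
  have htype : ∀ (i : ℕ) (hi : i < s),
      if i % 2 = 0 then IsProminent k f (ι ⟨i, hi⟩) else IsDeepValley k f (ι ⟨i, hi⟩) := by
    intro i
    induction i with
    | zero =>
      intro hi
      rw [if_pos rfl]
      refine (hmem _).resolve_right fun hv => ?_
      obtain ⟨r, hr, hpr⟩ := hv.exists_prominent_lt hk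
      obtain ⟨l, rfl⟩ := hsurj r (Or.inl hpr)
      rw [OrderEmbedding.lt_iff_lt, Fin.lt_def] at hr
      simp at hr
    | succ i ih =>
      intro hi
      have hi' := ih (by omega)
      split_ifs at hi' ⊢ with h1 h2 h2
      · omega
      · refine (hmem _).resolve_right fun hp => ?_
        obtain ⟨r, h3, h4, h5, -⟩ := hi'.1.exists_prominent_neg_between hk hp.1
          (neg_injective.comp hf) (hstep i hi)
        rw [neg_neg] at h5
        exact hnone i hi r h3 h4 (Or.inl h5)
      · refine (hmem _).resolve_left fun hp => ?_
        obtain ⟨r, h3, h4, h5, h6, -⟩ := hi'.exists_prominent_neg_between hk hp hf (hstep i hi)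
        exact hnone i hi r h3 h4 (Or.inr ⟨h5, _, h3, h6⟩)
      · omega
  have h1 := htype j (by omega)
  have h2 := htype (j + 1) hj
  split_ifs at h1 h2 ⊢
  · omega
  · exact h1.add_le_of_consecutive hk h2.1 (hstep j hj)
      (fun r h3 h4 h5 => absurd (Or.inl h5) (hnone j hj r h3 h4)) (Or.inl h2.2)
  · obtain ⟨x, hx, hxk⟩ := h1.2
    have := h1.1.add_le_of_consecutive hk (by rwa [neg_neg]) (hstep j hj)
      (fun r h3 h4 h5 y hy => by
        by_contra hcon
        simp only [Pi.neg_apply] at hcon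
        exact hnone j hj r h3 h4 (Or.inr ⟨h5, y, hy, by omega⟩))
      (Or.inr ⟨x, hx, by simp only [Pi.neg_apply]; omega⟩)
    simp only [Pi.neg_apply] at this
    omega
  · omega

open Classical in
theorem kAltLen_eq_card {n k : ℕ} (hk : 0 < k) (w : Equiv.Perm (Fin n)) :
    kAltLen n k w = (Finset.univ.filter fun p => IsProminent (k : ℤ) (entry w) p).card +
      (Finset.univ.filter fun p => IsDeepValley (k : ℤ) (entry w) p).card := by
  have hk' : (0 : ℤ) < k := by exact_mod_cast hk
  rw [← Finset.card_union_of_disjoint (Finset.disjoint_filter.2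
    fun p _ hp => hp.not_isDeepValley hk'), ← Finset.filter_or]
  unfold kAltLen
  simp only [isAltSeq_and_hasGaps_iff hk]
  refine IsGreatest.csSup_eq ⟨⟨Finset.orderEmbOfFin _ rfl, OrderEmbedding.strictMono _,
    alternating_orderEmbOfFin hk' (entry_injective w) rfl⟩, ?_⟩
  rintro s ⟨ι, hι, h⟩
  exact card_le_of_alternating hk' hι h

end AltLen

section Counting

variable {n : ℕ}

/-- The position of the `i`-th letter of a word of length `n` after the parts on the two sides of
its `j`-th letter have been exchanged. -/
def exchangePos (j i : Fin n) : Fin n :=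
  ⟨if i < j then i + (n - j) else if i = j then n - 1 - j else i - j - 1, by
    split_ifs with h1 h2
    · rw [Fin.lt_def] at h1; omega
    · omega
    · omega⟩

theorem exchangePos_self (j : Fin n) : exchangePos j j = Fin.rev j := by
  ext
  simp only [exchangePos, lt_irrefl, if_false, if_true, Fin.val_rev]
  omega

theorem exchangePos_rev_exchangePos (j i : Fin n) :
    exchangePos (Fin.rev j) (exchangePos j i) = i := by
  ext
  simp only [exchangePos, Fin.lt_def, Fin.ext_iff, Fin.val_rev]
  split_ifs <;> omega

theorem exchangePos_exchangePos_rev (j i : Fin n) :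
    exchangePos j (exchangePos (Fin.rev j) i) = i := by
  simpa using exchangePos_rev_exchangePos (Fin.rev j) i

/-- The arrangement obtained from `σ` by exchanging the parts on the two sides of `v`. -/
def exchangeSides (v : Fin n) (σ : Equiv.Perm (Fin n)) : Equiv.Perm (Fin n) :=
  σ.trans ⟨exchangePos (σ v), exchangePos (Fin.rev (σ v)), exchangePos_rev_exchangePos _,
    exchangePos_exchangePos_rev _⟩

theorem exchangeSides_apply (v : Fin n) (σ : Equiv.Perm (Fin n)) (u : Fin n) :
    exchangeSides v σ u = exchangePos (σ v) (σ u) := rfl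

theorem exchangeSides_involutive (v : Fin n) : Function.Involutive (exchangeSides v) := fun σ => by
  ext u
  rw [exchangeSides_apply, exchangeSides_apply, exchangeSides_apply, exchangePos_self,
    exchangePos_rev_exchangePos]

theorem exchangeSides_lt_iff (v : Fin n) (σ : Equiv.Perm (Fin n)) (x y : Fin n) :
    exchangeSides v σ x < exchangeSides v σ y ↔
      (σ v < σ x ∧ σ y ≤ σ v) ∨ (σ x = σ v ∧ σ y < σ v) ∨
        (σ x < σ y ∧ (σ v < σ x ∨ σ y < σ v)) := by
  simp only [exchangeSides_apply, exchangePos, Fin.lt_def, Fin.le_def, Fin.ext_iff]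
  split_ifs <;> omega

/-- Among the letters of `U`, the leftmost one lies in `A`. -/
def FirstIn (U A : Finset (Fin n)) (σ : Equiv.Perm (Fin n)) : Prop :=
  ∃ a ∈ A, ∀ u ∈ U, σ a ≤ σ u

/-- Among the letters of `U`, the rightmost one lies in `A`. -/
def LastIn (U A : Finset (Fin n)) (σ : Equiv.Perm (Fin n)) : Prop :=
  ∃ a ∈ A, ∀ u ∈ U, σ u ≤ σ a

theorem firstIn_exchangeSides_iff {v : Fin n} {S B : Finset (Fin n)} (hvB : v ∉ B)
    (hvS : v ∉ S) (hSB : Disjoint S B) (σ : Equiv.Perm (Fin n)) :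
    FirstIn (insert v (S ∪ B)) (insert v S) (exchangeSides v σ) ↔
      ∀ x ∈ B, σ v < σ x → ∃ y ∈ S, σ v < σ y ∧ σ y < σ x := by
  constructor
  · rintro ⟨a, ha, hmin⟩ x hx hlt
    have hax := hmin x (by simp [hx])
    rw [← not_lt, exchangeSides_lt_iff] at hax
    rcases Finset.mem_insert.1 ha with rfl | ha
    · exact absurd (Or.inl ⟨hlt, le_rfl⟩) hax
    · have hne : σ a ≠ σ x := fun h => Finset.disjoint_left.1 hSB ha (σ.injective h ▸ hx)
      have hne' : σ a ≠ σ v := fun h => hvS (σ.injective h ▸ ha)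
      refine ⟨a, ha, ?_⟩
      grind
  · intro h
    obtain ⟨a, ha, hmin⟩ := Finset.exists_min_image (insert v (S ∪ B)) (exchangeSides v σ)
      (Finset.insert_nonempty _ _)
    refine ⟨a, ?_, hmin⟩
    simp only [Finset.mem_insert, Finset.mem_union] at ha ⊢
    rcases ha with ha | ha | ha
    · exact Or.inl ha
    · exact Or.inr ha
    · exfalso
      have hav := hmin v (by simp)
      rw [← not_lt, exchangeSides_lt_iff] at hav
      have hne' : σ a ≠ σ v := fun h => hvB (σ.injective h ▸ ha)
      obtain ⟨y, hy, hvy, hya⟩ := h a ha (by grind)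
      have hay := hmin y (by simp [hy])
      rw [← not_lt, exchangeSides_lt_iff] at hay
      grind

theorem lastIn_exchangeSides_iff {v : Fin n} {S B : Finset (Fin n)} (hvB : v ∉ B)
    (hvS : v ∉ S) (hSB : Disjoint S B) (σ : Equiv.Perm (Fin n)) :
    LastIn (insert v (S ∪ B)) (insert v S) (exchangeSides v σ) ↔
      ∀ x ∈ B, σ x < σ v → ∃ y ∈ S, σ x < σ y ∧ σ y < σ v := by
  constructor
  · rintro ⟨a, ha, hmax⟩ x hx hlt
    have hax := hmax x (by simp [hx])
    rw [← not_lt, exchangeSides_lt_iff] at hax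
    rcases Finset.mem_insert.1 ha with rfl | ha
    · exact absurd (Or.inr (Or.inl ⟨rfl, hlt⟩)) hax
    · have hne : σ a ≠ σ x := fun h => Finset.disjoint_left.1 hSB ha (σ.injective h ▸ hx)
      have hne' : σ a ≠ σ v := fun h => hvS (σ.injective h ▸ ha)
      refine ⟨a, ha, ?_⟩
      grind
  · intro h
    obtain ⟨a, ha, hmax⟩ := Finset.exists_max_image (insert v (S ∪ B)) (exchangeSides v σ)
      (Finset.insert_nonempty _ _)
    refine ⟨a, ?_, hmax⟩
    simp only [Finset.mem_insert, Finset.mem_union] at ha ⊢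
    rcases ha with ha | ha | ha
    · exact Or.inl ha
    · exact Or.inr ha
    · exfalso
      have hav := hmax v (by simp)
      rw [← not_lt, exchangeSides_lt_iff] at hav
      have hne' : σ a ≠ σ v := fun h => hvB (σ.injective h ▸ ha)
      obtain ⟨y, hy, hvy, hya⟩ := h a ha (by grind)
      have hay := hmax y (by simp [hy])
      rw [← not_lt, exchangeSides_lt_iff] at hay
      grind

theorem lastIn_exchangeSides_iff_of_exists {v : Fin n} {S B : Finset (Fin n)} (hvB : v ∉ B)
    (hvS : v ∉ S) (hSB : Disjoint S B) (σ : Equiv.Perm (Fin n)) :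
    LastIn (insert v (S ∪ B)) S (exchangeSides v σ) ↔
      (∀ x ∈ B, σ x < σ v → ∃ y ∈ S, σ x < σ y ∧ σ y < σ v) ∧ ∃ y ∈ S, σ y < σ v := by
  rw [← lastIn_exchangeSides_iff hvB hvS hSB]
  constructor
  · rintro ⟨a, ha, hmax⟩
    refine ⟨⟨a, Finset.mem_insert_of_mem ha, hmax⟩, a, ha, ?_⟩
    have hav := hmax v (by simp)
    rw [← not_lt, exchangeSides_lt_iff] at hav
    have hne' : σ a ≠ σ v := fun h => hvS (σ.injective h ▸ ha)
    grind
  · rintro ⟨⟨a, ha, hmax⟩, y, hy, hlt⟩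
    rcases Finset.mem_insert.1 ha with rfl | ha
    · have hay := hmax y (by simp [hy])
      rw [← not_lt, exchangeSides_lt_iff] at hay
      grind
    · exact ⟨a, ha, hmax⟩

/-- Among the letters of `U`, the leftmost one is `e.1` and the rightmost one is `e.2`. -/
def HasEnds (U : Finset (Fin n)) (e : Fin n × Fin n) (σ : Equiv.Perm (Fin n)) : Prop :=
  ∀ u ∈ U, σ e.1 ≤ σ u ∧ σ u ≤ σ e.2

open Classical in
theorem card_hasEnds_eq {U : Finset (Fin n)} {e e' : Fin n × Fin n} (he : e ∈ U.offDiag)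
    (he' : e' ∈ U.offDiag) :
    (Finset.univ.filter (HasEnds U e)).card = (Finset.univ.filter (HasEnds U e')).card := by
  obtain ⟨x, y⟩ := e
  obtain ⟨x', y'⟩ := e'
  simp only [Finset.mem_offDiag] at he he'
  have hswap : ∀ a ∈ U, ∀ b ∈ U, ∀ u ∈ U, Equiv.swap a b u ∈ U := fun a ha b hb u hu => by
    rw [Equiv.swap_apply_def]
    split_ifs <;> assumption
  set z := Equiv.swap x x' y with hz
  have hzU : z ∈ U := hswap _ he.1 _ he'.1 _ he.2.1
  have hzx : z ≠ x' := fun h => he.2.2 (by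
    have : Equiv.swap x x' y = Equiv.swap x x' x := by rw [← hz, h, Equiv.swap_apply_left]
    exact ((Equiv.swap x x').injective this).symm)
  set g : Equiv.Perm (Fin n) := Equiv.swap z y' * Equiv.swap x x' with hg
  have hgx : g x = x' := by
    rw [hg, Equiv.Perm.mul_apply, Equiv.swap_apply_left,
      Equiv.swap_apply_of_ne_of_ne hzx.symm he'.2.2]
  have hgy : g y = y' := by
    rw [hg, Equiv.Perm.mul_apply, ← hz, Equiv.swap_apply_left]
  have hgU : ∀ u ∈ U, g u ∈ U := fun u hu =>
    hswap _ hzU _ he'.2.1 _ (hswap _ he.1 _ he'.1 _ hu)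
  have hgU' : ∀ u ∈ U, g⁻¹ u ∈ U := fun u hu => by
    rw [hg, mul_inv_rev, Equiv.swap_inv, Equiv.swap_inv]
    exact hswap _ he.1 _ he'.1 _ (hswap _ hzU _ he'.2.1 _ hu)
  symm
  refine Finset.card_equiv (Equiv.mulRight g) fun σ => ?_
  simp only [Finset.mem_filter, Finset.mem_univ, true_and, HasEnds, Equiv.coe_mulRight,
    Equiv.Perm.mul_apply, hgx, hgy]
  exact ⟨fun h u hu => h _ (hgU u hu), fun h u hu => by simpa using h _ (hgU' u hu)⟩

open Classical in
theorem card_firstIn_and_lastIn {U A B : Finset (Fin n)} (hU : 2 ≤ U.card) (hA : A ⊆ U)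
    (hB : B ⊆ U) :
    (Finset.univ.filter fun σ => FirstIn U A σ ∧ LastIn U B σ).card =
      ∑ e ∈ (A ×ˢ B).filter fun e => e.1 ≠ e.2, (Finset.univ.filter (HasEnds U e)).card := by
  rw [← Finset.card_biUnion]
  · congr 1
    ext σ
    simp only [Finset.mem_filter, Finset.mem_univ, true_and, Finset.mem_biUnion,
      Finset.mem_product, Prod.exists, HasEnds]
    constructor
    · rintro ⟨⟨a, ha, hmin⟩, b, hb, hmax⟩
      refine ⟨a, b, ⟨⟨ha, hb⟩, ?_⟩, fun u hu => ⟨hmin u hu, hmax u hu⟩⟩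
      rintro rfl
      obtain ⟨x, hx, y, hy, hxy⟩ := Finset.one_lt_card.1 hU
      refine hxy (σ.injective ?_)
      rw [le_antisymm (hmax x hx) (hmin x hx), le_antisymm (hmax y hy) (hmin y hy)]
    · rintro ⟨a, b, ⟨⟨ha, hb⟩, -⟩, h⟩
      exact ⟨⟨a, ha, fun u hu => (h u hu).1⟩, b, hb, fun u hu => (h u hu).2⟩
  · rintro ⟨a, b⟩ he ⟨a', b'⟩ he' hne
    simp only [Finset.mem_coe, Finset.mem_filter, Finset.mem_product] at he he'
    rw [Function.onFun, Finset.disjoint_filter]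
    intro σ _ h h'
    refine hne (Prod.ext (σ.injective ?_) (σ.injective ?_))
    · exact le_antisymm (h _ (hA he'.1.1)).1 (h' _ (hA he.1.1)).1
    · exact le_antisymm (h' _ (hB he.1.2)).2 (h _ (hB he'.1.2)).2

open Classical in
theorem card_offDiag_mul_card_firstIn_and_lastIn {U A B : Finset (Fin n)} (hU : 2 ≤ U.card)
    (hA : A ⊆ U) (hB : B ⊆ U) :
    U.offDiag.card * (Finset.univ.filter fun σ => FirstIn U A σ ∧ LastIn U B σ).card =
      ((A ×ˢ B).filter fun e => e.1 ≠ e.2).card * n ! := by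
  obtain ⟨x, hx, y, hy, hxy⟩ := Finset.one_lt_card.1 hU
  have he : (x, y) ∈ U.offDiag := Finset.mem_offDiag.2 ⟨hx, hy, hxy⟩
  have hUne : U.Nonempty := ⟨x, hx⟩
  have hcount : ∀ A B : Finset (Fin n), A ⊆ U → B ⊆ U →
      (Finset.univ.filter fun σ => FirstIn U A σ ∧ LastIn U B σ).card =
        ((A ×ˢ B).filter fun e => e.1 ≠ e.2).card *
          (Finset.univ.filter (HasEnds U (x, y))).card := by
    intro A B hA hB
    rw [card_firstIn_and_lastIn hU hA hB, ← smul_eq_mul]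
    refine Finset.sum_eq_card_nsmul fun e he' => card_hasEnds_eq ?_ he
    simp only [Finset.mem_filter, Finset.mem_product] at he'
    exact Finset.mem_offDiag.2 ⟨hA he'.1.1, hB he'.1.2, he'.2⟩
  have hall : n ! = U.offDiag.card * (Finset.univ.filter (HasEnds U (x, y))).card := by
    have := hcount U U subset_rfl subset_rfl
    rw [Finset.filter_true_of_mem fun σ _ =>
      ⟨Finset.exists_min_image U σ hUne, Finset.exists_max_image U σ hUne⟩, Finset.card_univ,
      Fintype.card_perm, Fintype.card_fin] at this
    rw [this]
    congr 2
    ext e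
    simp [and_assoc]
  rw [hcount A B hA hB, hall]
  ring

theorem card_filter_ne_add_card {A B : Finset (Fin n)} (h : B ⊆ A) :
    ((A ×ˢ B).filter fun e => e.1 ≠ e.2).card + B.card = A.card * B.card := by
  rw [← Finset.card_product, add_comm,
    ← Finset.card_filter_add_card_filter_not (s := A ×ˢ B) (fun e => e.1 = e.2)]
  congr 1
  refine Finset.card_bij (fun b _ => (b, b)) (fun b hb => by simp [hb, h hb])
    (fun b _ c _ hbc => (Prod.ext_iff.1 hbc).1) ?_
  rintro ⟨a, b⟩ hab
  simp only [Finset.mem_filter, Finset.mem_product] at hab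
  exact ⟨b, hab.1.2, by rw [hab.2]⟩

end Counting

section Average

variable {n : ℕ}

open Classical in
theorem sum_card_positions_eq_sum_card_values (Q : Equiv.Perm (Fin n) → Fin n → Prop) :
    ∑ w : Equiv.Perm (Fin n), (Finset.univ.filter fun p => Q w p).card =
      ∑ v : Fin n, (Finset.univ.filter fun σ : Equiv.Perm (Fin n) => Q σ⁻¹ (σ v)).card := by
  rw [← Equiv.sum_comp (Equiv.inv (Equiv.Perm (Fin n)))]
  have : ∀ σ : Equiv.Perm (Fin n), (Finset.univ.filter fun p => Q σ⁻¹ p).card =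
      (Finset.univ.filter fun v => Q σ⁻¹ (σ v)).card := fun σ =>
    (Finset.card_equiv σ fun v => by simp).symm
  simp only [Equiv.inv_apply, this]
  exact Finset.sum_card_bipartiteAbove_eq_sum_card_bipartiteBelow
    (fun (σ : Equiv.Perm (Fin n)) v => Q σ⁻¹ (σ v))

theorem isProminent_apply_iff (k : ℤ) (f : Fin n → ℤ) (σ : Equiv.Perm (Fin n)) (v : Fin n) :
    IsProminent k f (σ v) ↔
      (∀ x, σ x < σ v → f (σ v) < f (σ x) →
        ∃ y, σ x < σ y ∧ σ y < σ v ∧ f (σ y) + k ≤ f (σ v)) ∧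
      ∀ x, σ v < σ x → f (σ v) < f (σ x) →
        ∃ y, σ v < σ y ∧ σ y < σ x ∧ f (σ y) + k ≤ f (σ v) :=
  and_congr
    (σ.surjective.forall.trans <| forall_congr' fun _ => imp_congr_right fun _ =>
      imp_congr_right fun _ => σ.surjective.exists)
    (σ.surjective.forall.trans <| forall_congr' fun _ => imp_congr_right fun _ =>
      imp_congr_right fun _ => σ.surjective.exists)

theorem entry_inv_apply (σ : Equiv.Perm (Fin n)) (v : Fin n) :
    entry σ⁻¹ (σ v) = ((v : ℕ) : ℤ) := by
  simp [entry]

theorem isProminent_entry_inv_iff (k : ℕ) (σ : Equiv.Perm (Fin n)) (v : Fin n) :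
    IsProminent (k : ℤ) (entry σ⁻¹) (σ v) ↔
      (∀ x, v < x → σ x < σ v → ∃ y : Fin n, (y : ℕ) + k ≤ v ∧ σ x < σ y ∧ σ y < σ v) ∧
      ∀ x, v < x → σ v < σ x → ∃ y : Fin n, (y : ℕ) + k ≤ v ∧ σ v < σ y ∧ σ y < σ x := by
  rw [isProminent_apply_iff]
  simp only [entry_inv_apply, Fin.lt_def]
  refine and_congr ?_ ?_ <;>
  · refine forall_congr' fun x => ⟨fun h h1 h2 => ?_, fun h h1 h2 => ?_⟩
    · obtain ⟨y, h3⟩ := h h2 (by omega)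
      exact ⟨y, by omega⟩
    · obtain ⟨y, h3⟩ := h (by omega) h1
      exact ⟨y, by omega⟩

theorem isDeepValley_entry_inv_iff (k : ℕ) (σ : Equiv.Perm (Fin n)) (v : Fin n) :
    IsDeepValley (k : ℤ) (entry σ⁻¹) (σ v) ↔
      ((∀ x, x < v → σ x < σ v → ∃ y : Fin n, (v : ℕ) + k ≤ y ∧ σ x < σ y ∧ σ y < σ v) ∧
        ∃ y : Fin n, (v : ℕ) + k ≤ y ∧ σ y < σ v) ∧
      ∀ x, x < v → σ v < σ x → ∃ y : Fin n, (v : ℕ) + k ≤ y ∧ σ v < σ y ∧ σ y < σ x := by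
  rw [_root_.and_right_comm, IsDeepValley, isProminent_apply_iff, σ.surjective.exists]
  simp only [Pi.neg_apply, entry_inv_apply, Fin.lt_def]
  refine and_congr (and_congr ?_ ?_) (exists_congr fun x => by omega) <;>
  · refine forall_congr' fun x => ⟨fun h h1 h2 => ?_, fun h h1 h2 => ?_⟩
    · obtain ⟨y, h3⟩ := h h2 (by omega)
      exact ⟨y, by omega⟩
    · obtain ⟨y, h3⟩ := h (by omega) h1
      exact ⟨y, by omega⟩

theorem card_filter_val_add_le (m v : ℕ) (hv : v < n + m) :
    (Finset.univ.filter fun y : Fin n => (y : ℕ) + m ≤ v).card = v + 1 - m := by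
  have : (Finset.univ.filter fun y : Fin n => (y : ℕ) + m ≤ v) =
      Finset.univ.filter fun y : Fin n => (y : ℕ) < v + 1 - m := by
    ext y
    simp only [Finset.mem_filter, Finset.mem_univ, true_and]
    omega
  rw [this, Fin.card_filter_val_lt]
  omega

theorem card_filter_le_val (m : ℕ) :
    (Finset.univ.filter fun y : Fin n => m ≤ (y : ℕ)).card = n - m := by
  have := Finset.card_filter_add_card_filter_not (s := (Finset.univ : Finset (Fin n)))
    (fun y => (y : ℕ) < m)
  simp only [not_lt, Fin.card_filter_val_lt, Finset.card_univ, Fintype.card_fin] at this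
  omega

open Classical in
theorem card_prominent {k : ℕ} (hk : 0 < k) (hkn : k < n) (v : Fin n) :
    (n - k + 1) * (n - k) * (Finset.univ.filter fun σ : Equiv.Perm (Fin n) =>
      IsProminent (k : ℤ) (entry σ⁻¹) (σ v)).card =
      (v + 1 - k) * (v + 2 - k) * n ! := by
  set S : Finset (Fin n) := Finset.univ.filter fun y : Fin n => (y : ℕ) + k ≤ v with hS
  set B : Finset (Fin n) := Finset.Ioi v with hB
  have hvS : v ∉ S := by simp [hS, hk.ne']
  have hvB : v ∉ B := by simp [hB]
  have hSB : Disjoint S B := by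
    rw [Finset.disjoint_left]
    intro x hx hx'
    simp only [hS, hB, Finset.mem_filter, Finset.mem_univ, true_and, Finset.mem_Ioi,
      Fin.lt_def] at hx hx'
    omega
  have hScard : S.card = v + 1 - k := card_filter_val_add_le k v (by omega)
  have hBcard : B.card = n - 1 - v := by simp [hB]
  have hUcard : (insert v (S ∪ B)).card = v + 1 - k + (n - 1 - v) + 1 := by
    rw [Finset.card_insert_of_notMem (by simp [hvS, hvB]), Finset.card_union_of_disjoint hSB,
      hScard, hBcard]
  have hsub : insert v S ⊆ insert v (S ∪ B) :=
    Finset.insert_subset_insert _ Finset.subset_union_left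
  have hiff : (Finset.univ.filter fun σ : Equiv.Perm (Fin n) =>
      IsProminent (k : ℤ) (entry σ⁻¹) (σ v)).card = (Finset.univ.filter fun σ =>
        FirstIn (insert v (S ∪ B)) (insert v S) σ ∧
          LastIn (insert v (S ∪ B)) (insert v S) σ).card := by
    refine Finset.card_equiv (exchangeSides_involutive v).toPerm fun σ => ?_
    simp only [Finset.mem_filter, Finset.mem_univ, true_and, Function.Involutive.coe_toPerm,
      firstIn_exchangeSides_iff hvB hvS hSB, lastIn_exchangeSides_iff hvB hvS hSB,
      isProminent_entry_inv_iff]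
    rw [and_comm]
    simp [hS, hB]
  have hcount := card_offDiag_mul_card_firstIn_and_lastIn (by omega) hsub hsub
  have hpairs := card_filter_ne_add_card (subset_refl (insert v S))
  rw [Finset.card_insert_of_notMem hvS, hScard] at hpairs
  rw [← hiff, Finset.offDiag_card, hUcard] at hcount
  by_cases hv : k ≤ v
  · obtain ⟨i, hi⟩ := Nat.exists_eq_add_of_le hv
    obtain ⟨m, hm⟩ := Nat.exists_eq_add_of_lt hkn
    rw [show (v : ℕ) + 1 - k + (n - 1 - v) + 1 = m + 2 by omega,
      ← Nat.mul_sub_one] at hcount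
    rw [show (v : ℕ) + 1 - k = i + 1 by omega] at hpairs
    rw [show n - k + 1 = m + 2 by omega, show n - k = m + 2 - 1 by omega, hcount,
      show (v : ℕ) + 1 - k = i + 1 by omega, show (v : ℕ) + 2 - k = i + 2 by omega]
    congr 1
    linarith
  · rw [show (v : ℕ) + 1 - k = 0 by omega] at hpairs hcount ⊢
    rw [show ((insert v S ×ˢ insert v S).filter fun e => e.1 ≠ e.2).card = 0 by omega, zero_mul,
      ← Nat.mul_sub_one] at hcount
    rcases _root_.mul_eq_zero.1 hcount with h | h
    · exact absurd h (Nat.mul_ne_zero (by omega) (by omega))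
    · rw [h]
      simp

open Classical in
theorem card_deepValley {k : ℕ} (hk : 0 < k) (hkn : k < n) (v : Fin n) :
    (n - k + 1) * (n - k) * (Finset.univ.filter fun σ : Equiv.Perm (Fin n) =>
      IsDeepValley (k : ℤ) (entry σ⁻¹) (σ v)).card =
      (n - (v + k)) ^ 2 * n ! := by
  set S : Finset (Fin n) := Finset.univ.filter fun y : Fin n => (v : ℕ) + k ≤ y with hS
  set B : Finset (Fin n) := Finset.Iio v with hB
  have hvS : v ∉ S := by simp [hS, hk.ne']
  have hvB : v ∉ B := by simp [hB]
  have hSB : Disjoint S B := by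
    rw [Finset.disjoint_left]
    intro x hx hx'
    simp only [hS, hB, Finset.mem_filter, Finset.mem_univ, true_and, Finset.mem_Iio,
      Fin.lt_def] at hx hx'
    omega
  have hScard : S.card = n - (v + k) := card_filter_le_val _
  have hBcard : B.card = v := by simp [hB]
  have hUcard : (insert v (S ∪ B)).card = n - (v + k) + v + 1 := by
    rw [Finset.card_insert_of_notMem (by simp [hvS, hvB]), Finset.card_union_of_disjoint hSB,
      hScard, hBcard]
  have hsub : insert v S ⊆ insert v (S ∪ B) :=
    Finset.insert_subset_insert _ Finset.subset_union_left
  have hiff : (Finset.univ.filter fun σ : Equiv.Perm (Fin n) =>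
      IsDeepValley (k : ℤ) (entry σ⁻¹) (σ v)).card = (Finset.univ.filter fun σ =>
        FirstIn (insert v (S ∪ B)) (insert v S) σ ∧ LastIn (insert v (S ∪ B)) S σ).card := by
    refine Finset.card_equiv (exchangeSides_involutive v).toPerm fun σ => ?_
    simp only [Finset.mem_filter, Finset.mem_univ, true_and, Function.Involutive.coe_toPerm,
      firstIn_exchangeSides_iff hvB hvS hSB, lastIn_exchangeSides_iff_of_exists hvB hvS hSB,
      isDeepValley_entry_inv_iff]
    rw [and_comm]
    simp [hS, hB]
  have hcount := card_offDiag_mul_card_firstIn_and_lastIn (by omega) hsub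
    ((Finset.subset_insert v S).trans hsub)
  have hpairs := card_filter_ne_add_card (Finset.subset_insert v S)
  rw [Finset.card_insert_of_notMem hvS, hScard] at hpairs
  rw [← hiff, Finset.offDiag_card, hUcard] at hcount
  have hpairs' : ((insert v S ×ˢ S).filter fun e => e.1 ≠ e.2).card = (n - (v + k)) ^ 2 := by
    linarith
  rw [hpairs', ← Nat.mul_sub_one] at hcount
  by_cases hv : v + k ≤ n
  · rw [← hcount, show n - ((v : ℕ) + k) + v = n - k by omega, Nat.add_sub_cancel]
  · rw [show n - ((v : ℕ) + k) = 0 by omega] at hcount ⊢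
    rw [zero_pow two_ne_zero, zero_mul] at hcount ⊢
    rcases _root_.mul_eq_zero.1 hcount with h | h
    · exact absurd h (Nat.mul_ne_zero (by omega) (by omega))
    · rw [h, mul_zero]

theorem three_mul_sum_sub_mul (k m : ℕ) :
    3 * ∑ v ∈ Finset.range (k + m), (v + 1 - k) * (v + 2 - k) = m * (m + 1) * (m + 2) := by
  induction m with
  | zero =>
    rw [Finset.sum_eq_zero, mul_zero, zero_mul, zero_mul]
    intro v hv
    rw [add_zero, Finset.mem_range] at hv
    rw [show v + 1 - k = 0 by omega, zero_mul]
  | succ m ih =>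
    rw [← add_assoc, Finset.sum_range_succ, mul_add, ih, show k + m + 1 - k = m + 1 by omega,
      show k + m + 2 - k = m + 2 by omega]
    ring

theorem six_mul_sum_sub_sq (k m : ℕ) :
    6 * ∑ v ∈ Finset.range (k + m), (k + m - (v + k)) ^ 2 = m * (m + 1) * (2 * m + 1) := by
  induction m with
  | zero =>
    rw [Finset.sum_eq_zero, mul_zero, zero_mul, zero_mul]
    intro v _
    rw [show k + 0 - (v + k) = 0 by omega, zero_pow two_ne_zero]
  | succ m ih =>
    rw [← add_assoc, Finset.sum_range_succ', mul_add]
    simp only [show ∀ v, k + m + 1 - (v + 1 + k) = k + m - (v + k) by omega, ih,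
      show k + m + 1 - (0 + k) = m + 1 by omega]
    ring

end Average

/-- Armstrong's conjecture (the main theorem): for `n ≥ k+1 ≥ 2` the average
`k`-alternating length of permutations in `S_n` is `(4(n-k)+5)/6`, i.e.
`6 · Σ_w as_k(w) = (4(n-k)+5) · n!`. -/
theorem average_k_alternating_length (n k : ℕ) (hk : 2 ≤ k + 1) (hkn : k + 1 ≤ n) :
    6 * ∑ w : Equiv.Perm (Fin n), kAltLen n k w = (4 * (n - k) + 5) * n ! := by
  classical
  obtain ⟨m, rfl⟩ := Nat.exists_eq_add_of_le (Nat.le_of_succ_le hkn)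
  have hk0 : 0 < k := by omega
  have hpos : 0 < (m + 1) * m := by
    have : 0 < m := by omega
    positivity
  simp only [kAltLen_eq_card hk0]
  rw [Finset.sum_add_distrib, sum_card_positions_eq_sum_card_values,
    sum_card_positions_eq_sum_card_values]
  have hP := Finset.sum_congr rfl fun v (_ : v ∈ Finset.univ) =>
    card_prominent (n := k + m) hk0 (by omega) v
  have hV := Finset.sum_congr rfl fun v (_ : v ∈ Finset.univ) =>
    card_deepValley (n := k + m) hk0 (by omega) v
  rw [← Finset.mul_sum, ← Finset.sum_mul, Nat.add_sub_cancel_left,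
    Fin.sum_univ_eq_sum_range fun v => (v + 1 - k) * (v + 2 - k)] at hP
  rw [← Finset.mul_sum, ← Finset.sum_mul, Nat.add_sub_cancel_left,
    Fin.sum_univ_eq_sum_range fun v => (k + m - (v + k)) ^ 2] at hV
  have h3 := three_mul_sum_sub_mul k m
  have h6 := six_mul_sum_sub_sq k m
  rw [Nat.add_sub_cancel_left]
  refine Nat.eq_of_mul_eq_mul_left hpos ?_
  linear_combination 6 * hP + 6 * hV + (k + m)! * (2 * h3 + h6)
end

section
/- For all integers n and k with n ≥ k+1 ≥ 2, Σ_{w ∈ S_n} zs_k(w) = Σ_{w ∈ S_n} as_k(w) + n!/2; equivalently, the average k-zigzagging length exceeds the average k-alternating length of permutations in S_n by exactly 1/2. -/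
open Nat

/-- Alternation and the gap condition combined into one chain of inequalities in `ℕ`. -/
def IsKAltSeq (k : ℕ) {n : ℕ} (w : Equiv.Perm (Fin n)) {s : ℕ} (ι : Fin s → Fin n) : Prop :=
  StrictMono ι ∧
    ∀ (j : ℕ) (hj : j + 1 < s),
      if j % 2 = 0 then
        (w (ι ⟨j + 1, hj⟩) : ℕ) + k ≤ (w (ι ⟨j, Nat.lt_of_succ_lt hj⟩) : ℕ)
      else
        (w (ι ⟨j, Nat.lt_of_succ_lt hj⟩) : ℕ) + k ≤ (w (ι ⟨j + 1, hj⟩) : ℕ)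

/-- Reverse alternation and the gap condition combined into one chain of inequalities in `ℕ`. -/
def IsKRevAltSeq (k : ℕ) {n : ℕ} (w : Equiv.Perm (Fin n)) {s : ℕ} (ι : Fin s → Fin n) : Prop :=
  StrictMono ι ∧
    ∀ (j : ℕ) (hj : j + 1 < s),
      if j % 2 = 0 then
        (w (ι ⟨j, Nat.lt_of_succ_lt hj⟩) : ℕ) + k ≤ (w (ι ⟨j + 1, hj⟩) : ℕ)
      else
        (w (ι ⟨j + 1, hj⟩) : ℕ) + k ≤ (w (ι ⟨j, Nat.lt_of_succ_lt hj⟩) : ℕ)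

section

variable {n k s : ℕ} {w : Equiv.Perm (Fin n)}

lemma isAltSeq_and_hasGaps_iff_s2 (hk : 1 ≤ k) {ι : Fin s → Fin n} :
    IsAltSeq w ι ∧ HasGaps k w ι ↔ IsKAltSeq k w ι := by
  unfold IsAltSeq HasGaps IsKAltSeq
  rw [and_assoc, ← forall_and]
  refine and_congr_right fun _ => forall_congr' fun j => ?_
  rw [← forall_and]
  refine forall_congr' fun hj => ?_
  split_ifs <;> rw [le_abs] <;> omega

lemma isRevAltSeq_and_hasGaps_iff (hk : 1 ≤ k) {ι : Fin s → Fin n} :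
    IsRevAltSeq w ι ∧ HasGaps k w ι ↔ IsKRevAltSeq k w ι := by
  unfold IsRevAltSeq HasGaps IsKRevAltSeq
  rw [and_assoc, ← forall_and]
  refine and_congr_right fun _ => forall_congr' fun j => ?_
  rw [← forall_and]
  refine forall_congr' fun hj => ?_
  split_ifs <;> rw [le_abs] <;> omega

lemma strictMono_cons {a : Fin n} {ι : Fin (s + 1) → Fin n} (h : StrictMono ι) (ha : a < ι 0) :
    StrictMono (Fin.cons a ι : Fin (s + 2) → Fin n) := by
  rw [Fin.strictMono_iff_lt_succ]
  intro i
  refine Fin.cases ?_ (fun i => ?_) i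
  · simpa using ha
  · rw [← Fin.succ_castSucc, Fin.cons_succ, Fin.cons_succ]
    exact h i.castSucc_lt_succ

lemma IsKRevAltSeq.cons {ι : Fin (s + 1) → Fin n} (h : IsKRevAltSeq k w ι) {a : Fin n}
    (ha : IsKDown k w a (ι 0)) : IsKAltSeq k w (Fin.cons a ι : Fin (s + 2) → Fin n) := by
  refine ⟨strictMono_cons h.1 ha.1, fun j hj => ?_⟩
  rcases j with _ | j
  · exact ha.2
  · have h2 := h.2 j (by omega)
    change if (j + 1) % 2 = 0 then (w (ι ⟨j + 1, _⟩) : ℕ) + k ≤ w (ι ⟨j, _⟩)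
      else (w (ι ⟨j, _⟩) : ℕ) + k ≤ w (ι ⟨j + 1, _⟩)
    split_ifs at h2 ⊢ <;> first | exact h2 | omega

lemma IsKAltSeq.cons {ι : Fin (s + 1) → Fin n} (h : IsKAltSeq k w ι) {a : Fin n}
    (ha : IsKUp k w a (ι 0)) : IsKRevAltSeq k w (Fin.cons a ι : Fin (s + 2) → Fin n) := by
  refine ⟨strictMono_cons h.1 ha.1, fun j hj => ?_⟩
  rcases j with _ | j
  · exact ha.2
  · have h2 := h.2 j (by omega)
    change if (j + 1) % 2 = 0 then (w (ι ⟨j, _⟩) : ℕ) + k ≤ w (ι ⟨j + 1, _⟩)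
      else (w (ι ⟨j + 1, _⟩) : ℕ) + k ≤ w (ι ⟨j, _⟩)
    split_ifs at h2 ⊢ <;> first | exact h2 | omega

lemma IsKRevAltSeq.tail {ι : Fin (s + 1) → Fin n} (h : IsKRevAltSeq k w ι) :
    IsKAltSeq k w (Fin.tail ι) := by
  refine ⟨h.1.comp (Fin.strictMono_succ), fun j hj => ?_⟩
  have h2 := h.2 (j + 1) (by omega)
  change if j % 2 = 0 then (w (ι ⟨j + 1 + 1, _⟩) : ℕ) + k ≤ w (ι ⟨j + 1, _⟩)
      else (w (ι ⟨j + 1, _⟩) : ℕ) + k ≤ w (ι ⟨j + 1 + 1, _⟩)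
  split_ifs at h2 ⊢ <;> first | exact h2 | omega

lemma IsKAltSeq.tail {ι : Fin (s + 1) → Fin n} (h : IsKAltSeq k w ι) :
    IsKRevAltSeq k w (Fin.tail ι) := by
  refine ⟨h.1.comp (Fin.strictMono_succ), fun j hj => ?_⟩
  have h2 := h.2 (j + 1) (by omega)
  change if j % 2 = 0 then (w (ι ⟨j + 1, _⟩) : ℕ) + k ≤ w (ι ⟨j + 1 + 1, _⟩)
      else (w (ι ⟨j + 1 + 1, _⟩) : ℕ) + k ≤ w (ι ⟨j + 1, _⟩)
  split_ifs at h2 ⊢ <;> first | exact h2 | omega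

lemma isKRevAltSeq_iff_trans_revPerm {ι : Fin s → Fin n} :
    IsKRevAltSeq k w ι ↔ IsKAltSeq k (w.trans Fin.revPerm) ι := by
  unfold IsKAltSeq IsKRevAltSeq
  refine and_congr_right fun _ => forall_congr' fun j => forall_congr' fun hj => ?_
  simp only [Equiv.trans_apply, Fin.revPerm_apply, Fin.val_rev]
  split_ifs <;> omega

/-- The lengths of a family of strictly increasing position sequences, if inhabited,
have their supremum as greatest element. -/
lemma isGreatest_sSup_lengths {P : (s : ℕ) → (Fin s → Fin n) → Prop}
    (hP : ∀ s ι, P s ι → StrictMono ι) (h0 : ∃ s ι, P s ι) :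
    IsGreatest {s | ∃ ι, P s ι} (sSup {s | ∃ ι, P s ι}) := by
  have hb : BddAbove {s | ∃ ι, P s ι} := by
    refine ⟨n, ?_⟩
    rintro s ⟨ι, h⟩
    simpa using Fintype.card_le_of_injective ι (hP s ι h).injective
  exact ⟨Nat.sSup_mem h0 hb, fun s hs => le_csSup hb hs⟩

lemma isGreatest_kAltLen (hk : 1 ≤ k) (w : Equiv.Perm (Fin n)) :
    IsGreatest {s : ℕ | ∃ ι : Fin s → Fin n, IsKAltSeq k w ι} (kAltLen n k w) := by
  unfold kAltLen
  simp only [isAltSeq_and_hasGaps_iff_s2 hk]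
  exact isGreatest_sSup_lengths (P := fun _ ι => IsKAltSeq k w ι) (fun s ι h => h.1)
    ⟨0, Fin.elim0, fun i => i.elim0, fun j hj => by omega⟩

lemma kRevAltLen_eq_kAltLen_trans_revPerm (hk : 1 ≤ k) (w : Equiv.Perm (Fin n)) :
    kRevAltLen n k w = kAltLen n k (w.trans Fin.revPerm) := by
  simp only [kRevAltLen, kAltLen, isAltSeq_and_hasGaps_iff_s2 hk, isRevAltSeq_and_hasGaps_iff hk,
    isKRevAltSeq_iff_trans_revPerm]

lemma isGreatest_kRevAltLen (hk : 1 ≤ k) (w : Equiv.Perm (Fin n)) :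
    IsGreatest {s : ℕ | ∃ ι : Fin s → Fin n, IsKRevAltSeq k w ι} (kRevAltLen n k w) := by
  simpa only [isKRevAltSeq_iff_trans_revPerm, kRevAltLen_eq_kAltLen_trans_revPerm hk]
    using isGreatest_kAltLen hk (w.trans Fin.revPerm)

lemma kZigLen_eq_max (hk : 1 ≤ k) (w : Equiv.Perm (Fin n)) :
    kZigLen n k w = max (kAltLen n k w) (kRevAltLen n k w) := by
  have hset : {s : ℕ | ∃ ι : Fin s → Fin n, (IsAltSeq w ι ∨ IsRevAltSeq w ι) ∧ HasGaps k w ι} =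
      {s : ℕ | ∃ ι : Fin s → Fin n, IsKAltSeq k w ι} ∪
        {s : ℕ | ∃ ι : Fin s → Fin n, IsKRevAltSeq k w ι} := by
    ext s
    simp only [or_and_right, isAltSeq_and_hasGaps_iff_s2 hk, isRevAltSeq_and_hasGaps_iff hk,
      exists_or, Set.mem_ofPred_eq, Set.mem_union]
  rw [kZigLen, hset]
  exact ((isGreatest_kAltLen hk w).union (isGreatest_kRevAltLen hk w)).csSup_eq

lemma kAltLen_le_kRevAltLen_add_one (hk : 1 ≤ k) (w : Equiv.Perm (Fin n)) :
    kAltLen n k w ≤ kRevAltLen n k w + 1 := by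
  obtain ⟨ι, h⟩ := (isGreatest_kAltLen hk w).1
  generalize kAltLen n k w = s at ι h
  rcases s with _ | s
  · omega
  · have := (isGreatest_kRevAltLen hk w).2 ⟨_, h.tail⟩
    omega

lemma isKAltSeq_singleton (a : Fin n) : IsKAltSeq k w (fun _ : Fin 1 => a) :=
  ⟨fun i j h => absurd h (by simp [Subsingleton.elim i j]), fun j hj => by omega⟩

lemma isKRevAltSeq_singleton (a : Fin n) : IsKRevAltSeq k w (fun _ : Fin 1 => a) :=
  ⟨fun i j h => absurd h (by simp [Subsingleton.elim i j]), fun j hj => by omega⟩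

/-- If a `k`-down is completed before any `k`-up is, then the longest `k`-reverse-alternating
subsequence is shorter than the longest `k`-alternating one. -/
lemma kRevAltLen_lt_kAltLen_of_isKDown (hk : 1 ≤ k) {a t : Fin n} (hat : IsKDown k w a t)
    (hup : ∀ c d, d ≤ t → ¬ IsKUp k w c d) : kRevAltLen n k w < kAltLen n k w := by
  obtain ⟨ι, h⟩ := (isGreatest_kRevAltLen hk w).1
  have hle := (isGreatest_kAltLen hk w).2
  generalize kRevAltLen n k w = s at ι h
  rcases s with _ | _ | s
  · exact lt_of_lt_of_le (by omega) (hle ⟨_, isKAltSeq_singleton a⟩)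
  · exact hle ⟨_, (isKRevAltSeq_singleton t).cons hat⟩
  · have h01 : IsKUp k w (ι 0) (ι 1) := ⟨h.1 (by simp), h.2 0 (by omega)⟩
    have ht : t < ι 1 := lt_of_not_ge fun hge => hup _ _ hge h01
    obtain ⟨b, hb, hmin⟩ := (Finset.Iio (ι 1)).exists_min_image (fun i => (w i : ℕ))
      ⟨t, Finset.mem_Iio.2 ht⟩
    rw [Finset.mem_Iio] at hb
    have hbt := hmin t (Finset.mem_Iio.2 ht)
    have hb0 := hmin (ι 0) (Finset.mem_Iio.2 h01.1)
    have hba : (w b : ℕ) + k ≤ w a := by have := hat.2; omega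
    have hab : a < b := by
      rcases lt_trichotomy a b with h' | rfl | h'
      · exact h'
      · omega
      · exact absurd ⟨h', hba⟩ (hup b a hat.1.le)
    have hrev : IsKRevAltSeq k w (Fin.cons b (Fin.tail ι) : Fin (s + 2) → Fin n) :=
      h.tail.cons ⟨hb, by have := h01.2; change (w b : ℕ) + k ≤ w (ι 1); omega⟩
    exact hle ⟨_, hrev.cons (a := a) ⟨hab, hba⟩⟩

lemma isKUp_trans_revPerm {a b : Fin n} :
    IsKUp k (w.trans Fin.revPerm) a b ↔ IsKDown k w a b := by
  simp only [IsKUp, IsKDown, Equiv.trans_apply, Fin.revPerm_apply, Fin.val_rev]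
  refine and_congr_right fun _ => ?_
  omega

lemma isKDown_trans_revPerm {a b : Fin n} :
    IsKDown k (w.trans Fin.revPerm) a b ↔ IsKUp k w a b := by
  simp only [IsKUp, IsKDown, Equiv.trans_apply, Fin.revPerm_apply, Fin.val_rev]
  refine and_congr_right fun _ => ?_
  omega

lemma trans_revPerm_trans_revPerm (w : Equiv.Perm (Fin n)) :
    (w.trans Fin.revPerm).trans Fin.revPerm = w := by
  ext i; simp

lemma kAltLen_lt_kRevAltLen_of_isKUp (hk : 1 ≤ k) {a t : Fin n} (hat : IsKUp k w a t)
    (hdown : ∀ c d, d ≤ t → ¬ IsKDown k w c d) : kAltLen n k w < kRevAltLen n k w := by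
  have := kRevAltLen_lt_kAltLen_of_isKDown (w := w.trans Fin.revPerm) hk
    (isKDown_trans_revPerm.2 hat) (fun c d hd => isKUp_trans_revPerm.not.2 (hdown c d hd))
  rwa [kRevAltLen_eq_kAltLen_trans_revPerm hk, trans_revPerm_trans_revPerm,
    ← kRevAltLen_eq_kAltLen_trans_revPerm hk] at this

lemma kRevAltLen_le_kAltLen_add_one (hk : 1 ≤ k) (w : Equiv.Perm (Fin n)) :
    kRevAltLen n k w ≤ kAltLen n k w + 1 := by
  have := kAltLen_le_kRevAltLen_add_one hk (w.trans Fin.revPerm)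
  rwa [kRevAltLen_eq_kAltLen_trans_revPerm hk (w.trans _), trans_revPerm_trans_revPerm,
    ← kRevAltLen_eq_kAltLen_trans_revPerm hk] at this

lemma exists_isKUp_or_isKDown (hk : 1 ≤ k) (hkn : k + 1 ≤ n) (w : Equiv.Perm (Fin n)) :
    ∃ t a, IsKUp k w a t ∨ IsKDown k w a t := by
  obtain ⟨p, hp⟩ := w.surjective ⟨0, by omega⟩
  obtain ⟨q, hq⟩ := w.surjective ⟨n - 1, by omega⟩
  have hp' : (w p : ℕ) = 0 := by rw [hp]
  have hq' : (w q : ℕ) = n - 1 := by rw [hq]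
  rcases lt_trichotomy p q with h | rfl | h
  · exact ⟨q, p, .inl ⟨h, by omega⟩⟩
  · omega
  · exact ⟨p, q, .inr ⟨h, by omega⟩⟩

lemma kAltLen_ne_kRevAltLen (hk : 1 ≤ k) (hkn : k + 1 ≤ n) (w : Equiv.Perm (Fin n)) :
    kAltLen n k w ≠ kRevAltLen n k w := by
  obtain ⟨t, ⟨a, hat⟩, hmin⟩ := WellFounded.has_min wellFounded_lt
    {t | ∃ a, IsKUp k w a t ∨ IsKDown k w a t} (exists_isKUp_or_isKDown hk hkn w)
  have hno : ∀ c d, d < t → ¬ (IsKUp k w c d ∨ IsKDown k w c d) :=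
    fun c d hd h => hmin d ⟨c, h⟩ hd
  -- The first completed section cannot end both a `k`-up and a `k`-down.
  have hexcl : ∀ c d, IsKUp k w c t → ¬ IsKDown k w d t := by
    rintro c d ⟨hc, hc'⟩ ⟨hd, hd'⟩
    rcases lt_trichotomy c d with h | rfl | h
    · exact hno c d hd (.inl ⟨h, by omega⟩)
    · omega
    · exact hno d c hc (.inr ⟨h, by omega⟩)
  rcases hat with hat | hat
  · refine (kAltLen_lt_kRevAltLen_of_isKUp hk hat fun c d hd h => ?_).ne
    rcases hd.lt_or_eq with hd | rfl
    · exact hno c d hd (.inr h)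
    · exact hexcl _ _ hat h
  · refine (kRevAltLen_lt_kAltLen_of_isKDown hk hat fun c d hd h => ?_).ne'
    rcases hd.lt_or_eq with hd | rfl
    · exact hno c d hd (.inl h)
    · exact hexcl _ _ h hat

lemma two_mul_kZigLen (hk : 1 ≤ k) (hkn : k + 1 ≤ n) (w : Equiv.Perm (Fin n)) :
    2 * kZigLen n k w = kAltLen n k w + kRevAltLen n k w + 1 := by
  have h1 := kAltLen_le_kRevAltLen_add_one hk w
  have h2 := kRevAltLen_le_kAltLen_add_one hk w
  have h3 := kAltLen_ne_kRevAltLen hk hkn w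
  rw [kZigLen_eq_max hk]
  omega

lemma sum_kRevAltLen (hk : 1 ≤ k) :
    ∑ w : Equiv.Perm (Fin n), kRevAltLen n k w = ∑ w : Equiv.Perm (Fin n), kAltLen n k w := by
  simp only [kRevAltLen_eq_kAltLen_trans_revPerm hk]
  exact Equiv.sum_comp (Equiv.mulLeft (Fin.revPerm : Equiv.Perm (Fin n))) (fun w => kAltLen n k w)

end

/-- For `n ≥ k+1 ≥ 2`, `Σ_w zs_k(w) = Σ_w as_k(w) + n!/2`; equivalently (clearing the
denominator), `2 · Σ_w zs_k(w) = 2 · Σ_w as_k(w) + n!`. -/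
theorem sum_zig_eq_sum_alt_add_half_factorial (n k : ℕ) (hk : 2 ≤ k + 1) (hkn : k + 1 ≤ n) :
    2 * ∑ w : Equiv.Perm (Fin n), kZigLen n k w =
      2 * ∑ w : Equiv.Perm (Fin n), kAltLen n k w + n ! := by
  have hk' : 1 ≤ k := by omega
  rw [Finset.mul_sum, Finset.sum_congr rfl fun w _ => two_mul_kZigLen hk' hkn w,
    Finset.sum_add_distrib, Finset.sum_add_distrib, sum_kRevAltLen hk', Finset.sum_const,
    Finset.card_univ, Fintype.card_perm, Fintype.card_fin]
  simp only [smul_eq_mul, mul_one]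
  ring
end

section
/- Let w = w_1 ⋯ w_n be a permutation of {1,…,n} and suppose the section w_i ⋯ w_j is k-ascending. If there is an index t > j with w_j < w_t and there is no k-down in w_j ⋯ w_t (no j ≤ s < s' ≤ t with w_s - w_{s'} ≥ k), then there exists t' with j < t' ≤ t such that w_i ⋯ w_{t'} is k-ascending. -/
open Nat

/-- Prolonging a `k`-ascending section from the right: if `w_i ⋯ w_j` is `k`-ascending,
`t > j`, `w_j < w_t` and there is no `k`-down in `w_j ⋯ w_t`, then `w_i ⋯ w_{t'}` is
`k`-ascending for some `j < t' ≤ t`. -/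
theorem prolong_right (n k : ℕ) (hk : 2 ≤ k + 1) (hkn : k + 1 ≤ n)
    (w : Equiv.Perm (Fin n)) (i j t : Fin n)
    (hasc : IsKAsc k w i j) (hjt : j < t) (hval : (w j : ℕ) < (w t : ℕ))
    (hnodown : ∀ s s' : Fin n, j ≤ s → s' ≤ t → ¬ IsKDown k w s s') :
    ∃ t' : Fin n, j < t' ∧ t' ≤ t ∧ IsKAsc k w i t' := by
  obtain ⟨hij, hext, hgap, hdown⟩ := hasc
  have hdown_j : ∀ x, j < x → x ≤ t → (w j : ℕ) < (w x : ℕ) + k := fun x hx hxt =>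
    not_le.mp fun h => hnodown j x le_rfl hxt ⟨hx, h⟩
  obtain ⟨m, hm, hmax⟩ := Finset.exists_max_image (Finset.Icc j t) (fun x => (w x : ℕ))
    ⟨t, Finset.mem_Icc.mpr ⟨hjt.le, le_rfl⟩⟩
  simp only [Finset.mem_Icc] at hm hmax
  have hjm_val : (w j : ℕ) < (w m : ℕ) := hval.trans_le (hmax t ⟨hjt.le, le_rfl⟩)
  have hjm : j < m := hm.1.lt_of_ne (by rintro rfl; exact lt_irrefl _ hjm_val)
  refine ⟨m, hjm, hm.2, hij.trans hjm, fun x hix hxm => ?_, by omega, ?_⟩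
  · rcases le_or_gt x j with hxj | hjx
    · exact ⟨(hext x hix hxj).1, (hext x hix hxj).2.trans hjm_val.le⟩
    · have := hdown_j x hjx (hxm.trans hm.2)
      exact ⟨by omega, hmax x ⟨hjx.le, hxm.trans hm.2⟩⟩
  · rintro s u his hum ⟨hsu, hd⟩
    rcases le_or_gt u j with huj | hju
    · exact hdown s u his huj ⟨hsu, hd⟩
    rcases le_or_gt j s with hjs | hsj
    · exact hnodown s u hjs (hum.trans hm.2) ⟨hsu, hd⟩
    · have := hdown_j u hju (hum.trans hm.2)
      have := (hext s his hsj.le).2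
      omega
end

section
/- Let w = w_1 ⋯ w_n be a permutation of {1,…,n} and suppose the section w_i ⋯ w_j is k-ascending. If there is an index s < i with w_s < w_i and there is no k-down in w_s ⋯ w_i (no s ≤ r < r' ≤ i with w_r - w_{r'} ≥ k), then there exists s' with s ≤ s' < i such that w_{s'} ⋯ w_j is k-ascending. -/
open Nat

/-- Prolonging a `k`-ascending section from the left: if `w_i ⋯ w_j` is `k`-ascending,
`s < i`, `w_s < w_i` and there is no `k`-down in `w_s ⋯ w_i`, then `w_{s'} ⋯ w_j` is
`k`-ascending for some `s ≤ s' < i`. -/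
theorem prolong_left (n k : ℕ) (hk : 2 ≤ k + 1) (hkn : k + 1 ≤ n)
    (w : Equiv.Perm (Fin n)) (i j s : Fin n)
    (hasc : IsKAsc k w i j) (hsi : s < i) (hval : (w s : ℕ) < (w i : ℕ))
    (hnodown : ∀ r r' : Fin n, s ≤ r → r' ≤ i → ¬ IsKDown k w r r') :
    ∃ s' : Fin n, s ≤ s' ∧ s' < i ∧ IsKAsc k w s' j := by
  obtain ⟨hij, hmm, hup, hdn⟩ := hasc
  obtain ⟨m, hm, hmin⟩ := (Finset.Icc s i).exists_min_image (fun t => (w t : ℕ))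
    ⟨s, Finset.mem_Icc.2 ⟨le_rfl, hsi.le⟩⟩
  obtain ⟨hsm, hmi⟩ := Finset.mem_Icc.1 hm
  have hms : (w m : ℕ) ≤ w s := hmin s (Finset.mem_Icc.2 ⟨le_rfl, hsi.le⟩)
  have hlt : m < i := lt_of_le_of_ne hmi (by rintro rfl; omega)
  have hbound : ∀ r, s ≤ r → r < i → (w r : ℕ) < w i + k := fun r hr hri =>
    not_le.1 fun h => hnodown r i hr le_rfl ⟨hri, h⟩
  refine ⟨m, hsm, hlt, hlt.trans hij, fun t hmt htj => ?_, by omega, fun r r' hr hr' hd => ?_⟩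
  · rcases lt_or_ge t i with hti | hit
    · have h₁ := hmin t (Finset.mem_Icc.2 ⟨hsm.trans hmt, hti.le⟩)
      have h₂ := hbound t (hsm.trans hmt) hti
      exact ⟨h₁, by omega⟩
    · have h := hmm t hit htj
      exact ⟨by omega, h.2⟩
  · rcases lt_or_ge r i with hri | hir
    · rcases le_or_gt r' i with hri' | hir'
      · exact hnodown r r' (hsm.trans hr) hri' hd
      · have h₁ := hbound r (hsm.trans hr) hri
        have h₂ := (hmm r' hir'.le hr').1
        have h₃ := hd.2
        omega
    · exact hdn r r' hir hr' hd
end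

section
/- Let w = w_1 ⋯ w_n be a permutation of {1,…,n}, let w_i ⋯ w_j be a k-up (i < j, w_j - w_i ≥ k), and let i ≤ i' < j' ≤ j be such that w_{i'} ⋯ w_{j'} is a k-up with j' - i' minimal among all k-ups contained in w_i ⋯ w_j. Then w_{i'} ⋯ w_{j'} is a k-ascending section. -/
open Nat

/-- A shortest `k`-up inside a `k`-up is a `k`-ascending section. -/
theorem shortest_kUp_is_kAsc (n k : ℕ) (hk : 2 ≤ k + 1) (hkn : k + 1 ≤ n)
    (w : Equiv.Perm (Fin n)) (i j i' j' : Fin n)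
    (hup : IsKUp k w i j) (hii' : i ≤ i') (hj'j : j' ≤ j)
    (hup' : IsKUp k w i' j')
    (hmin : ∀ a b : Fin n, i ≤ a → b ≤ j → IsKUp k w a b →
      (j' : ℕ) - (i' : ℕ) ≤ (b : ℕ) - (a : ℕ)) :
    IsKAsc k w i' j' := by
  obtain ⟨hlt, hgap⟩ := hup'
  have ends_eq : ∀ a b : Fin n, i' ≤ a → b ≤ j' → IsKUp k w a b → a = i' ∧ b = j' := by
    intro a b ha hb hab
    have hlen := hmin a b (hii'.trans ha) (hb.trans hj'j) hab
    have hab' := hab.1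
    simp only [Fin.ext_iff, Fin.le_def, Fin.lt_def] at *
    omega
  have bounds : ∀ t : Fin n, i' ≤ t → t ≤ j' →
      (w i' : ℕ) ≤ (w t : ℕ) ∧ (w t : ℕ) ≤ (w j' : ℕ) := by
    intro t hit htj
    constructor
    · by_contra! hwt
      have htj' : t < j' := lt_of_le_of_ne htj (by rintro rfl; omega)
      obtain ⟨rfl, -⟩ := ends_eq t j' hit le_rfl ⟨htj', by omega⟩
      exact lt_irrefl _ hwt
    · by_contra! hwt
      have hit' : i' < t := lt_of_le_of_ne hit (by rintro rfl; omega)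
      obtain ⟨-, rfl⟩ := ends_eq i' t le_rfl htj ⟨hit', by omega⟩
      exact lt_irrefl _ hwt
  refine ⟨hlt, bounds, hgap, ?_⟩
  rintro s t his htj ⟨hst, hdown⟩
  have hwt := (bounds t (his.trans hst.le) htj).1
  have his' : i' < s := lt_of_le_of_ne his (by rintro rfl; omega)
  obtain ⟨-, rfl⟩ := ends_eq i' s le_rfl (hst.le.trans htj) ⟨his', by omega⟩
  exact absurd hst htj.not_gt
end

section
/- Let w = w_1 ⋯ w_n be a permutation of {1,…,n}. If w_i ⋯ w_j is a maximal k-ascending section and w_{i'} ⋯ w_{j'} is a maximal k-descending section of w, then the intersection of the index intervals [i,j] and [i',j'] contains at most one index. -/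
open Nat

/-- The intersection of a `k`-ascending and a `k`-descending section contains at most one
index; maximality is not needed. -/
theorem IsKAsc.inter_isKDesc_subsingleton {n k : ℕ} {w : Equiv.Perm (Fin n)}
    {i j i' j' : Fin n} (hasc : IsKAsc k w i j) (hdesc : IsKDesc k w i' j') :
    (Set.Icc i j ∩ Set.Icc i' j').Subsingleton := by
  obtain ⟨hij, hbd, hup, hnd⟩ := hasc
  obtain ⟨hij', hbd', hdown, hnu⟩ := hdesc
  have heq (a b : Fin n) (h : (w a : ℕ) ≤ w b) (h' : (w b : ℕ) ≤ w a) : a = b :=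
    w.injective (Fin.ext (h.antisymm h'))
  rintro p ⟨⟨hip, hpj⟩, hip', hpj'⟩ q ⟨⟨hiq, hqj⟩, hiq', hqj'⟩
  rcases le_total i i' with hi | hi <;> rcases le_total j j' with hj | hj
  · have hi'j : i' ≤ j := hip'.trans hpj
    obtain rfl := heq i' j (hbd i' hi hi'j).2 (hbd' j hi'j hj).1
    exact (hpj.antisymm hip').trans (hqj.antisymm hiq').symm
  · exact absurd ⟨hij', hdown⟩ (hnd i' j' hi hj)
  · exact absurd ⟨hij, hup⟩ (hnu i j hi hj)
  · have hij'' : i ≤ j' := hip.trans hpj'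
    obtain rfl := heq i j' (hbd j' hij'' hj).1 (hbd' i hi hij'').2
    exact (hpj'.antisymm hip).trans (hqj'.antisymm hiq).symm

/-- The intersection of a maximal `k`-ascending section and a maximal `k`-descending
section contains at most one index. -/
theorem maxAsc_inter_maxDesc_subsingleton (n k : ℕ) (hk : 2 ≤ k + 1) (hkn : k + 1 ≤ n)
    (w : Equiv.Perm (Fin n)) (i j i' j' : Fin n)
    (h1 : IsMaxKAsc k w i j) (h2 : IsMaxKDesc k w i' j') :
    ∀ p q : Fin n, i ≤ p → p ≤ j → i' ≤ p → p ≤ j' →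
      i ≤ q → q ≤ j → i' ≤ q → q ≤ j' → p = q := by
  intro p q hip hpj hip' hpj' hiq hqj hiq' hqj'
  exact h1.1.inter_isKDesc_subsingleton h2.1 ⟨⟨hip, hpj⟩, hip', hpj'⟩ ⟨⟨hiq, hqj⟩, hiq', hqj'⟩
end

section
/- Let w = w_1 ⋯ w_n be a permutation of {1,…,n}. If w_i ⋯ w_j and w_{i'} ⋯ w_{j'} are two distinct maximal k-ascending sections of w, then the index intervals [i,j] and [i',j'] are disjoint. -/
open Nat

/-- If two `k`-ascending sections overlap, with the second one ending later, then their union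
is `k`-ascending. -/
theorem IsKAsc.union {k n : ℕ} {w : Equiv.Perm (Fin n)} {i j i' j' : Fin n}
    (h : IsKAsc k w i j) (h' : IsKAsc k w i' j') (hi : i ≤ i') (hij : i' ≤ j) (hj : j ≤ j') :
    IsKAsc k w i j' := by
  obtain ⟨hlt, hb, -, hd⟩ := h
  obtain ⟨-, hb', hg', hd'⟩ := h'
  have hi' := hb i' hi hij
  have hj' := hb' j hij hj
  refine ⟨hlt.trans_le hj, fun t hit htj => ?_, by omega, fun s t his htj hst => ?_⟩
  · rcases le_total t j with ht | ht
    · have := hb t hit ht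
      omega
    · have := hb' t (hij.trans ht) htj
      omega
  · rcases le_or_gt t j with ht | ht
    · exact hd s t his ht hst
    rcases le_or_gt i' s with hs | hs
    · exact hd' s t hs htj hst
    have hw := (hb' t (hij.trans ht.le) htj).1
    have hst' := hst.2
    exact hd s i' his hij ⟨hs, by omega⟩

/-- Overlapping maximal `k`-ascending sections coincide, if the first one starts no later. -/
theorem IsMaxKAsc.eq_of_overlap {k n : ℕ} {w : Equiv.Perm (Fin n)} {i j i' j' : Fin n}
    (h : IsMaxKAsc k w i j) (h' : IsMaxKAsc k w i' j') (hi : i ≤ i') (hij : i' ≤ j) :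
    i = i' ∧ j = j' := by
  rcases le_total j' j with hj | hj
  · exact h'.2 i j h.1 hi hj
  · have hu := h.1.union h'.1 hi hij hj
    exact ⟨(h'.2 i j' hu hi le_rfl).1, (h.2 i j' hu le_rfl hj).2.symm⟩

/-- Two distinct maximal `k`-ascending sections have disjoint index intervals. -/
theorem distinct_maxAsc_disjoint (n k : ℕ) (hk : 2 ≤ k + 1) (hkn : k + 1 ≤ n)
    (w : Equiv.Perm (Fin n)) (i j i' j' : Fin n)
    (h1 : IsMaxKAsc k w i j) (h2 : IsMaxKAsc k w i' j')
    (hne : (i, j) ≠ (i', j')) :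
    ∀ p : Fin n, i ≤ p → p ≤ j → ¬ (i' ≤ p ∧ p ≤ j') := by
  rintro p hip hpj ⟨hip', hpj'⟩
  rcases le_total i i' with hi | hi
  · obtain ⟨rfl, rfl⟩ := h1.eq_of_overlap h2 hi (hip'.trans hpj)
    exact hne rfl
  · obtain ⟨rfl, rfl⟩ := h2.eq_of_overlap h1 hi (hip.trans hpj')
    exact hne rfl
end
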